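/- For every n ≥ 1 and every F ∈ B_ρ, the function h = J_{n+1}[F] extends to a function analytic on the whole disk D_ρ (in particular it is analytic at both points z = −1 and z = 1) and satisfies on D_ρ the linear ODE (1−x²) h′(x) + n[(b−a) − (a+b)x] h(x) = F(x) − Φ_{n+1}[F]. Moreover, Φ_{n+1}[F] is the unique constant λ ∈ ℂ for which the equation (1−x²) h′ + n[(b−a) − (a+b)x] h = F − λ admits a solution analytic in a neighborhood of both −1 and 1. -/

import Mathlib

open Complex Set Metric

/-- The Beta function `B(p,q) = Γ(p)Γ(q)/Γ(p+q)`. -/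
noncomputable def cBeta (p q : ℂ) : ℂ := Complex.Gamma p * Complex.Gamma q / Complex.Gamma (p + q)

/-- The functional `Φ_{ν+1}[F] = (2^{1-ν(a+b)}/B(νa,νb)) ∫_{-1}^1 (1-t)^{νa-1}(1+t)^{νb-1} F(t) dt`
(principal complex powers). -/
noncomputable def PhiOp (a b ν : ℂ) (F : ℂ → ℂ) : ℂ :=
  (2 : ℂ) ^ (1 - ν * (a + b)) / cBeta (ν * a) (ν * b) *
    ∫ t in (-1 : ℝ)..1, (1 - (t : ℂ)) ^ (ν * a - 1) * (1 + (t : ℂ)) ^ (ν * b - 1) * F (t : ℂ)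

/-- The operator `J_{ν+1}[F](z) = (1-z)^{-νa}(1+z)^{-νb} ∫_{-1}^z
(1-t)^{νa-1}(1+t)^{νb-1}(F(t)-Φ_{ν+1}[F]) dt`, the integral being taken along the straight
segment from `-1` to `z`, parametrized by `t = -1 + s(z+1)`, `s ∈ [0,1]`. -/
noncomputable def JOp (a b ν : ℂ) (F : ℂ → ℂ) (z : ℂ) : ℂ :=
  (1 - z) ^ (-(ν * a)) * (1 + z) ^ (-(ν * b)) *
    ∫ s in (0 : ℝ)..1, (z + 1) *
      ((1 - (-1 + (s : ℂ) * (z + 1))) ^ (ν * a - 1) * (1 + (-1 + (s : ℂ) * (z + 1))) ^ (ν * b - 1) *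
        (F (-1 + (s : ℂ) * (z + 1)) - PhiOp a b ν F))

/-- Points off the two branch cuts `(-∞,-1]` and `[1,∞)` of the principal powers. -/
def OffCut (z : ℂ) : Prop := z.im ≠ 0 ∨ (-1 < z.re ∧ z.re < 1)

/-- The weighted mean `∫₀¹ s^{β-1} A(sv) ds` of `A` along the segment from `0` to `v`. -/
noncomputable def radialMean (β : ℂ) (A : ℂ → ℂ) (v : ℂ) : ℂ :=
  ∫ s in (0 : ℝ)..1, (s : ℂ) ^ (β - 1) * A (s * v)

lemma continuousOn_comp_ofReal_mul {s : Set ℂ} {A : ℂ → ℂ} (hA : ContinuousOn A s) {v : ℂ}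
    (hv : ∀ r ∈ Icc (0 : ℝ) 1, (r : ℂ) * v ∈ s) :
    ContinuousOn (fun r : ℝ ↦ A (r * v)) (Icc 0 1) :=
  hA.comp (f := fun r : ℝ ↦ (r : ℂ) * v) (by fun_prop) hv

lemma intervalIntegrable_cpow_mul {β : ℂ} (hβ : 0 < β.re) {g : ℝ → ℂ}
    (hg : ContinuousOn g (Icc 0 1)) :
    IntervalIntegrable (fun r : ℝ ↦ (r : ℂ) ^ (β - 1) * g r) MeasureTheory.volume 0 1 :=
  (intervalIntegral.intervalIntegrable_cpow' (by simpa using hβ)).mul_continuousOn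
    (by rwa [uIcc_of_le zero_le_one])

lemma integral_cpow_mul_radial_deriv {s : Set ℂ} (hs : IsOpen s) {β : ℂ} (hβ : 0 < β.re)
    {B : ℂ → ℂ} (hB : DifferentiableOn ℂ B s) {v : ℂ}
    (hv : ∀ r ∈ Icc (0 : ℝ) 1, (r : ℂ) * v ∈ s) :
    ∫ r in (0 : ℝ)..1, (r : ℂ) ^ (β - 1) * (β * B (r * v) + r * v * deriv B (r * v)) = B v := by
  have hβ0 : β ≠ 0 := by rintro rfl; simp at hβ
  have hc := continuousOn_comp_ofReal_mul hB.continuousOn hv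
  have hc' := continuousOn_comp_ofReal_mul (hB.deriv hs).continuousOn hv
  have key := intervalIntegral.integral_eq_sub_of_hasDerivAt_of_le (a := 0) (b := 1)
    (f := fun r : ℝ ↦ (r : ℂ) ^ β * B (r * v))
    (f' := fun r : ℝ ↦ (r : ℂ) ^ (β - 1) * (β * B (r * v) + r * v * deriv B (r * v)))
    zero_le_one ?_ ?_ ?_
  · rw [key]
    simp [zero_cpow hβ0]
  · refine ContinuousOn.mul (fun r _ ↦ ?_) hc
    exact (Complex.continuousAt_ofReal_cpow_const r β (Or.inl hβ)).continuousWithinAt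
  · intro r hr
    have hr0 : (r : ℂ) ≠ 0 := by exact_mod_cast hr.1.ne'
    have h1 : HasDerivAt (fun r : ℝ ↦ (r : ℂ) ^ β) (β * (r : ℂ) ^ (β - 1)) r := by
      have := (hasDerivAt_id (r : ℂ)).cpow_const (c := β) (Or.inl (by simpa using hr.1))
      simpa using this.comp_ofReal
    have h2 : HasDerivAt (fun r : ℝ ↦ B (r * v)) (deriv B (r * v) * v) r := by
      have hd := (hB.differentiableAt (hs.mem_nhds (hv r ⟨hr.1.le, hr.2.le⟩))).hasDerivAt
      have hm : HasDerivAt (fun z : ℂ ↦ z * v) v (r : ℂ) := by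
        simpa using (hasDerivAt_id (r : ℂ)).mul_const v
      exact (HasDerivAt.comp (r : ℂ) hd hm).comp_ofReal
    have h3 : (r : ℂ) ^ β = (r : ℂ) ^ (β - 1) * r := by
      rw [cpow_sub _ _ hr0, cpow_one, div_mul_cancel₀ _ hr0]
    refine (h1.mul h2).congr_deriv ?_
    rw [h3]; ring
  · exact intervalIntegrable_cpow_mul hβ
      ((continuousOn_const.mul hc).add ((by fun_prop : ContinuousOn _ _).mul hc'))

lemma eq_radialMean {s : Set ℂ} (hs : IsOpen s)
    (hstar : ∀ v ∈ s, ∀ r ∈ Icc (0 : ℝ) 1, (r : ℂ) * v ∈ s) {β : ℂ} (hβ : 0 < β.re)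
    {A H : ℂ → ℂ} (hH : DifferentiableOn ℂ H s)
    (hode : ∀ v ∈ s, v * deriv H v + β * H v = A v) {v : ℂ} (hv : v ∈ s) :
    H v = radialMean β A v := by
  rw [← integral_cpow_mul_radial_deriv hs hβ hH (hstar v hv), radialMean]
  refine intervalIntegral.integral_congr fun r hr ↦ ?_
  rw [uIcc_of_le zero_le_one] at hr
  simp only [← hode _ (hstar v hv r hr)]
  ring

lemma hasDerivAt_radialMean {s : Set ℂ} (hs : IsOpen s)
    (hstar : ∀ v ∈ s, ∀ r ∈ Icc (0 : ℝ) 1, (r : ℂ) * v ∈ s) {β : ℂ} (hβ : 0 < β.re)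
    {A : ℂ → ℂ} (hA : DifferentiableOn ℂ A s) {v : ℂ} (hv : v ∈ s) :
    HasDerivAt (radialMean β A)
      (∫ r in (0 : ℝ)..1, (r : ℂ) ^ (β - 1) * (r * deriv A (r * v))) v := by
  obtain ⟨ε, hε, hεs⟩ := Metric.nhds_basis_closedBall.mem_iff.1 (hs.mem_nhds hv)
  have hK : IsCompact ((fun p : ℝ × ℂ ↦ (p.1 : ℂ) * p.2) '' (Icc 0 1 ×ˢ closedBall v ε)) :=
    (isCompact_Icc.prod (isCompact_closedBall v ε)).image (by fun_prop)
  have hKs : (fun p : ℝ × ℂ ↦ (p.1 : ℂ) * p.2) '' (Icc 0 1 ×ˢ closedBall v ε) ⊆ s := by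
    rintro _ ⟨p, hp, rfl⟩
    exact hstar _ (hεs hp.2) _ hp.1
  obtain ⟨C, hC⟩ := hK.exists_bound_of_continuousOn ((hA.deriv hs).continuousOn.mono hKs)
  have hmeas : ∀ {g : ℝ → ℂ}, ContinuousOn g (Icc 0 1) → MeasureTheory.AEStronglyMeasurable
      (fun r : ℝ ↦ (r : ℂ) ^ (β - 1) * g r) (MeasureTheory.volume.restrict (uIoc 0 1)) := by
    intro g hg
    exact (intervalIntegrable_iff.1 (intervalIntegrable_cpow_mul hβ hg)).aestronglyMeasurable
  refine (intervalIntegral.hasDerivAt_integral_of_dominated_loc_of_deriv_le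
    (μ := MeasureTheory.volume) (a := 0) (b := 1)
    (F := fun v (r : ℝ) ↦ (r : ℂ) ^ (β - 1) * A (r * v))
    (F' := fun v (r : ℝ) ↦ (r : ℂ) ^ (β - 1) * (r * deriv A (r * v)))
    (bound := fun r ↦ r ^ (β.re - 1) * C) (closedBall_mem_nhds v hε) ?_ ?_ ?_ ?_ ?_ ?_).2
  · filter_upwards [hs.mem_nhds hv] with w hw
    exact hmeas (continuousOn_comp_ofReal_mul hA.continuousOn (hstar w hw))
  · exact intervalIntegrable_cpow_mul hβ (continuousOn_comp_ofReal_mul hA.continuousOn (hstar v hv))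
  · have := continuousOn_comp_ofReal_mul (hA.deriv hs).continuousOn (hstar v hv)
    exact hmeas (by fun_prop)
  · refine Filter.Eventually.of_forall fun r hr w hw ↦ ?_
    rw [uIoc_of_le zero_le_one] at hr
    have h1 := hC _ ⟨(r, w), ⟨⟨hr.1.le, hr.2⟩, hw⟩, rfl⟩
    rw [norm_mul, norm_mul, Complex.norm_cpow_eq_rpow_re_of_pos hr.1, norm_real,
      Real.norm_of_nonneg hr.1.le]
    simp only [sub_re, one_re]
    have h0 : 0 ≤ r ^ (β.re - 1) := Real.rpow_nonneg hr.1.le _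
    have h2 := norm_nonneg (deriv A (r * w))
    gcongr
    nlinarith [hr.1, hr.2]
  · exact (intervalIntegral.intervalIntegrable_rpow' (by linarith)).mul_const C
  · refine Filter.Eventually.of_forall fun r hr w hw ↦ ?_
    rw [uIoc_of_le zero_le_one] at hr
    have hd := (hA.differentiableAt
      (hs.mem_nhds (hstar w (hεs hw) r ⟨hr.1.le, hr.2⟩))).hasDerivAt
    have hm : HasDerivAt (fun z : ℂ ↦ (r : ℂ) * z) (r : ℂ) w := by
      simpa using (hasDerivAt_id w).const_mul (r : ℂ)
    have := (HasDerivAt.comp w hd hm).const_mul ((r : ℂ) ^ (β - 1))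
    rw [mul_comm (deriv A _)] at this
    exact this

lemma radialMean_ode {s : Set ℂ} (hs : IsOpen s)
    (hstar : ∀ v ∈ s, ∀ r ∈ Icc (0 : ℝ) 1, (r : ℂ) * v ∈ s) {β : ℂ} (hβ : 0 < β.re)
    {A : ℂ → ℂ} (hA : DifferentiableOn ℂ A s) {v : ℂ} (hv : v ∈ s) :
    v * deriv (radialMean β A) v + β * radialMean β A v = A v := by
  have hc := continuousOn_comp_ofReal_mul hA.continuousOn (hstar v hv)
  have hc' := continuousOn_comp_ofReal_mul (hA.deriv hs).continuousOn (hstar v hv)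
  rw [(hasDerivAt_radialMean hs hstar hβ hA hv).deriv, radialMean,
    ← integral_cpow_mul_radial_deriv hs hβ hA (hstar v hv),
    ← intervalIntegral.integral_const_mul, ← intervalIntegral.integral_const_mul,
    ← intervalIntegral.integral_add]
  · refine intervalIntegral.integral_congr fun r _ ↦ ?_
    ring
  · exact (intervalIntegrable_cpow_mul hβ (by fun_prop)).const_mul v
  · exact (intervalIntegrable_cpow_mul hβ hc).const_mul β

/-- `h` is holomorphic on `s` and solves
`(1 - z²) h' + ((β - α) - (α + β) z) h = G` there. -/
def IsJacobiSolution (α β : ℂ) (G h : ℂ → ℂ) (s : Set ℂ) : Prop :=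
  DifferentiableOn ℂ h s ∧
    ∀ z ∈ s, (1 - z ^ 2) * deriv h z + ((β - α) - (α + β) * z) * h z = G z

/-- `s` with the cut `[1, ∞)` removed. -/
def leftDomain (s : Set ℂ) : Set ℂ := {z | z ∈ s ∧ 1 - z ∈ slitPlane}

lemma isOpen_leftDomain {s : Set ℂ} (hs : IsOpen s) : IsOpen (leftDomain s) :=
  hs.inter (isOpen_slitPlane.preimage (by fun_prop : Continuous fun z : ℂ ↦ 1 - z))

lemma ofReal_mul_sub_one_mem_leftDomain {s : Set ℂ} (hs : Convex ℝ s) (hm : (-1 : ℂ) ∈ s)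
    {v : ℂ} (hv : v - 1 ∈ leftDomain s) {r : ℝ} (hr : r ∈ Icc (0 : ℝ) 1) :
    (r : ℂ) * v - 1 ∈ leftDomain s := by
  refine ⟨?_, ?_⟩
  · have := hs hm hv.1 (sub_nonneg.2 hr.2) hr.1 (by ring)
    convert this using 1
    simp only [real_smul]
    push_cast
    ring
  · have h2 := hv.2
    rw [mem_slitPlane_iff] at h2 ⊢
    simp only [sub_re, sub_im, mul_re, mul_im, ofReal_re, ofReal_im, one_re, one_im] at h2 ⊢
    rcases eq_or_lt_of_le hr.1 with h0 | h0
    · left; simp [← h0]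
    rcases h2 with h | h
    · left; nlinarith [hr.2, mul_pos h0 h]
    · right
      intro h3
      apply h
      have : r * v.im = 0 := by linarith
      rcases mul_eq_zero.1 this with h4 | h4
      · exact absurd h4 h0.ne'
      · simp [h4]

/-- The local solution which is holomorphic at `-1`. -/
noncomputable def leftSolution (α β : ℂ) (G : ℂ → ℂ) (z : ℂ) : ℂ :=
  (1 - z) ^ (-α) * radialMean β (fun v ↦ (2 - v) ^ (α - 1) * G (v - 1)) (z + 1)

lemma hasDerivAt_const_sub_cpow (α : ℂ) {a z : ℂ} (hz : a - z ∈ slitPlane) :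
    HasDerivAt (fun z ↦ (a - z) ^ α) (-(α * (a - z) ^ (α - 1))) z := by
  have := ((hasDerivAt_id z).const_sub a).cpow_const (c := α) hz
  simpa using this

lemma mem_slitPlane_of_sub_one_mem {s : Set ℂ} {v : ℂ} (hv : v - 1 ∈ leftDomain s) :
    2 - v ∈ slitPlane := by
  have := hv.2
  rwa [show 1 - (v - 1) = 2 - v by ring] at this

lemma differentiableOn_leftWeight {s : Set ℂ} (hs : IsOpen s) {G : ℂ → ℂ}
    (hG : DifferentiableOn ℂ G s) (α : ℂ) :
    DifferentiableOn ℂ (fun v ↦ (2 - v) ^ α * G (v - 1)) {v | v - 1 ∈ leftDomain s} := by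
  intro v hv
  have h1 := (hasDerivAt_const_sub_cpow α (mem_slitPlane_of_sub_one_mem hv)).differentiableAt
  have h2 : DifferentiableAt ℂ (fun v ↦ G (v - 1)) v :=
    (hG.differentiableAt (hs.mem_nhds hv.1)).comp v
      (by fun_prop : DifferentiableAt ℂ (fun v : ℂ ↦ v - 1) v)
  exact (h1.mul h2).differentiableWithinAt

lemma isOpen_shift {s : Set ℂ} (hs : IsOpen s) : IsOpen {v | v - 1 ∈ leftDomain s} :=
  (isOpen_leftDomain hs).preimage (by fun_prop : Continuous fun v : ℂ ↦ v - 1)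

lemma isJacobiSolution_leftSolution {s : Set ℂ} (hs : IsOpen s) (hsc : Convex ℝ s)
    (hm : (-1 : ℂ) ∈ s) {α β : ℂ} (hβ : 0 < β.re) {G : ℂ → ℂ} (hG : DifferentiableOn ℂ G s) :
    IsJacobiSolution α β G (leftSolution α β G) (leftDomain s) := by
  have hA := differentiableOn_leftWeight hs hG (α - 1)
  have hstar : ∀ v ∈ {v | v - 1 ∈ leftDomain s}, ∀ r ∈ Icc (0 : ℝ) 1,
      (r : ℂ) * v ∈ {v | v - 1 ∈ leftDomain s} :=
    fun v hv r hr ↦ ofReal_mul_sub_one_mem_leftDomain hsc hm hv hr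
  have main : ∀ z ∈ leftDomain s, ∃ h', HasDerivAt (leftSolution α β G) h' z ∧
      (1 - z ^ 2) * h' + ((β - α) - (α + β) * z) * leftSolution α β G z = G z := by
    intro z hz
    have hz' : z + 1 ∈ {v | v - 1 ∈ leftDomain s} := by simpa using hz
    have h1 := hasDerivAt_const_sub_cpow (-α) hz.2
    have h2 := hasDerivAt_radialMean (isOpen_shift hs) hstar hβ hA hz'
    have hode := radialMean_ode (isOpen_shift hs) hstar hβ hA hz'
    have h3 := h1.mul (h2.comp_add_const z 1)
    refine ⟨_, h3, ?_⟩
    rw [← h2.deriv]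
    have h0 := slitPlane_ne_zero hz.2
    rw [leftSolution]
    set H := radialMean β (fun v ↦ (2 - v) ^ (α - 1) * G (v - 1)) (z + 1)
    set H' := deriv (radialMean β (fun v ↦ (2 - v) ^ (α - 1) * G (v - 1))) (z + 1)
    have e1 : (1 - z) ^ (-α - 1) * (1 - z) = (1 - z) ^ (-α) := by
      rw [cpow_sub _ _ h0, cpow_one, div_mul_cancel₀ _ h0]
    have e2 : (1 - z) ^ (-α) * (1 - z) * (1 - z) ^ (α - 1) = 1 := by
      rw [cpow_sub _ _ h0, cpow_one, cpow_neg]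
      have h4 : (1 - z) ^ α ≠ 0 := by rw [cpow_def_of_ne_zero h0]; exact exp_ne_zero _
      field_simp
    rw [show 2 - (z + 1) = 1 - z by ring, add_sub_cancel_right] at hode
    linear_combination (α * (1 + z) * H) * e1 + (1 - z) ^ (-α) * (1 - z) * hode + G z * e2
  refine ⟨fun z hz ↦ ?_, fun z hz ↦ ?_⟩
  · obtain ⟨h', hd, -⟩ := main z hz
    exact hd.differentiableAt.differentiableWithinAt
  · obtain ⟨h', hd, he⟩ := main z hz
    rwa [hd.deriv]

lemma IsJacobiSolution.eq_leftSolution {s : Set ℂ} (hs : IsOpen s) (hsc : Convex ℝ s)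
    (hm : (-1 : ℂ) ∈ s) {α β : ℂ} (hβ : 0 < β.re) {G h : ℂ → ℂ}
    (hh : IsJacobiSolution α β G h (leftDomain s)) {z : ℂ} (hz : z ∈ leftDomain s) :
    h z = leftSolution α β G z := by
  have hstar : ∀ v ∈ {v | v - 1 ∈ leftDomain s}, ∀ r ∈ Icc (0 : ℝ) 1,
      (r : ℂ) * v ∈ {v | v - 1 ∈ leftDomain s} :=
    fun v hv r hr ↦ ofReal_mul_sub_one_mem_leftDomain hsc hm hv hr
  have hz' : z + 1 ∈ {v | v - 1 ∈ leftDomain s} := by simpa using hz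
  have hd : ∀ v ∈ {v | v - 1 ∈ leftDomain s}, HasDerivAt (fun v ↦ (2 - v) ^ α * h (v - 1))
      (-(α * (2 - v) ^ (α - 1)) * h (v - 1) + (2 - v) ^ α * deriv h (v - 1)) v := by
    intro v hv
    have h2 := (hh.1.differentiableAt ((isOpen_leftDomain hs).mem_nhds hv)).hasDerivAt
    exact (hasDerivAt_const_sub_cpow α (mem_slitPlane_of_sub_one_mem hv)).mul
      (h2.comp_sub_const v 1)
  have key := eq_radialMean (isOpen_shift hs) hstar hβ
    (A := fun v ↦ (2 - v) ^ (α - 1) * G (v - 1)) (H := fun v ↦ (2 - v) ^ α * h (v - 1))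
    (fun v hv ↦ (hd v hv).differentiableAt.differentiableWithinAt) ?_ hz'
  · rw [leftSolution, ← key, show 2 - (z + 1) = 1 - z by ring, add_sub_cancel_right, cpow_neg,
      inv_mul_cancel_left₀]
    rw [cpow_def_of_ne_zero (slitPlane_ne_zero hz.2)]
    exact exp_ne_zero _
  · intro v hv
    rw [(hd v hv).deriv]
    have h0 := slitPlane_ne_zero (mem_slitPlane_of_sub_one_mem hv)
    have e1 : (2 - v) ^ (α - 1) * (2 - v) = (2 - v) ^ α := by
      rw [cpow_sub _ _ h0, cpow_one, div_mul_cancel₀ _ h0]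
    have e2 := hh.2 _ hv
    linear_combination (2 - v) ^ (α - 1) * e2 - (v * deriv h (v - 1) + β * h (v - 1)) * e1

lemma IsJacobiSolution.mono {α β : ℂ} {G h : ℂ → ℂ} {s t : Set ℂ}
    (hh : IsJacobiSolution α β G h t) (hst : s ⊆ t) : IsJacobiSolution α β G h s :=
  ⟨hh.1.mono hst, fun z hz ↦ hh.2 z (hst hz)⟩

lemma IsJacobiSolution.reflect {α β : ℂ} {G h : ℂ → ℂ} {s : Set ℂ} (hs : IsOpen s)
    (hh : IsJacobiSolution α β G h s) :
    IsJacobiSolution β α (fun z ↦ G (-z)) (fun z ↦ -h (-z)) (Neg.neg ⁻¹' s) := by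
  have hd : ∀ z ∈ Neg.neg ⁻¹' s, HasDerivAt (fun z ↦ -h (-z)) (deriv h (-z)) z := by
    intro z hz
    have h1 := (hh.1.differentiableAt (hs.mem_nhds hz)).hasDerivAt
    exact (h1.comp z (hasDerivAt_neg z)).neg.congr_deriv (by ring)
  refine ⟨fun z hz ↦ (hd z hz).differentiableAt.differentiableWithinAt, fun z hz ↦ ?_⟩
  rw [(hd z hz).deriv]
  linear_combination hh.2 _ hz

lemma leftSolution_zero_eq_integral {α β : ℂ} (hβ : 0 < β.re) {G : ℂ → ℂ}
    (hG : ContinuousOn (fun t : ℝ ↦ G t) (Icc (-1) 1)) :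
    IntervalIntegrable (fun t : ℝ ↦ (1 - (t : ℂ)) ^ (α - 1) * (1 + (t : ℂ)) ^ (β - 1) * G t)
      MeasureTheory.volume (-1) 0 ∧
    ∫ t in (-1 : ℝ)..0, (1 - (t : ℂ)) ^ (α - 1) * (1 + (t : ℂ)) ^ (β - 1) * G t =
      leftSolution α β G 0 := by
  have hshift : ∀ r : ℝ, (1 - ((r - 1 : ℝ) : ℂ)) ^ (α - 1) * (1 + ((r - 1 : ℝ) : ℂ)) ^ (β - 1) *
      G ((r - 1 : ℝ) : ℂ) = (r : ℂ) ^ (β - 1) * ((2 - r) ^ (α - 1) * G ((r - 1 : ℝ) : ℂ)) := by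
    intro r
    push_cast
    rw [show 1 - ((r : ℂ) - 1) = 2 - r by ring, add_sub_cancel]
    ring
  have hc : ContinuousOn (fun r : ℝ ↦ (2 - (r : ℂ)) ^ (α - 1) * G ((r - 1 : ℝ) : ℂ))
      (Icc 0 1) := by
    refine ContinuousOn.mul (fun r hr ↦ ?_) ?_
    · refine (ContinuousAt.cpow (by fun_prop) (by fun_prop) ?_).continuousWithinAt
      rw [mem_slitPlane_iff]
      left
      simp only [sub_re, re_ofNat, ofReal_re]
      linarith [hr.2]
    · exact hG.comp (f := fun r : ℝ ↦ r - 1) (by fun_prop)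
        fun r hr ↦ ⟨by linarith [hr.1], by linarith [hr.2]⟩
  have hint := intervalIntegrable_cpow_mul hβ hc
  constructor
  · have := hint.comp_add_right 1
    simp only [zero_sub, sub_self] at this
    refine this.congr fun t _ ↦ ?_
    have h := hshift (t + 1)
    rw [add_sub_cancel_right] at h
    simp only [add_sub_cancel_right, h]
  · have := intervalIntegral.integral_comp_sub_right (a := 0) (b := 1)
      (fun t : ℝ ↦ (1 - (t : ℂ)) ^ (α - 1) * (1 + (t : ℂ)) ^ (β - 1) * G t) 1
    rw [zero_sub, sub_self] at this
    rw [← this]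
    simp only [hshift]
    simp [leftSolution, radialMean]

lemma jacobi_integral_eq {α β : ℂ} (hα : 0 < α.re) (hβ : 0 < β.re) {G : ℂ → ℂ}
    (hG : ContinuousOn (fun t : ℝ ↦ G t) (Icc (-1) 1)) :
    IntervalIntegrable (fun t : ℝ ↦ (1 - (t : ℂ)) ^ (α - 1) * (1 + (t : ℂ)) ^ (β - 1) * G t)
      MeasureTheory.volume (-1) 1 ∧
    ∫ t in (-1 : ℝ)..1, (1 - (t : ℂ)) ^ (α - 1) * (1 + (t : ℂ)) ^ (β - 1) * G t =
      leftSolution α β G 0 + leftSolution β α (fun z ↦ G (-z)) 0 := by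
  have hL := leftSolution_zero_eq_integral (α := α) hβ hG
  have hG' : ContinuousOn (fun t : ℝ ↦ G (-t)) (Icc (-1) 1) := by
    have := hG.comp (f := fun t : ℝ ↦ -t) (s := Icc (-1) 1) (by fun_prop)
      fun r hr ↦ ⟨by linarith [hr.2], by linarith [hr.1]⟩
    simpa [Function.comp_def] using this
  have hR := leftSolution_zero_eq_integral (α := β) (G := fun z ↦ G (-z)) hα hG'
  have hrefl : (fun t : ℝ ↦ (1 - (t : ℂ)) ^ (β - 1) * (1 + (t : ℂ)) ^ (α - 1) * G (-t)) =
      fun t ↦ (fun t : ℝ ↦ (1 - (t : ℂ)) ^ (α - 1) * (1 + (t : ℂ)) ^ (β - 1) * G t) (-t) := by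
    funext t
    simp only [ofReal_neg, sub_neg_eq_add, ← sub_eq_add_neg]
    ring
  rw [hrefl] at hR
  have hR1 : IntervalIntegrable
      (fun t : ℝ ↦ (1 - (t : ℂ)) ^ (α - 1) * (1 + (t : ℂ)) ^ (β - 1) * G t)
      MeasureTheory.volume 0 1 := by
    rw [IntervalIntegrable.iff_comp_neg, neg_zero]
    exact hR.1.symm
  have hR2 := (intervalIntegral.integral_comp_neg (a := -1) (b := 0)
    (fun t : ℝ ↦ (1 - (t : ℂ)) ^ (α - 1) * (1 + (t : ℂ)) ^ (β - 1) * G t)).symm.trans hR.2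
  rw [neg_zero, neg_neg] at hR2
  exact ⟨hL.1.trans hR1, by rw [← intervalIntegral.integral_add_adjacent_intervals hL.1 hR1,
    hL.2, hR2]⟩

lemma continuousOn_ofReal_Icc_of_convex {s : Set ℂ} (hsc : Convex ℝ s) (hm : (-1 : ℂ) ∈ s)
    (hp : (1 : ℂ) ∈ s) {G : ℂ → ℂ} (hG : ContinuousOn G s) :
    ContinuousOn (fun t : ℝ ↦ G t) (Icc (-1) 1) := by
  refine hG.comp (by fun_prop) fun t ht ↦ ?_
  have := hsc hm hp (a := (1 - t) / 2) (b := (1 + t) / 2) (by linarith [ht.2])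
    (by linarith [ht.1]) (by ring)
  convert this using 1
  simp only [real_smul]
  push_cast
  ring

lemma zero_mem_leftDomain {s : Set ℂ} (hsc : Convex ℝ s) (hm : (-1 : ℂ) ∈ s)
    (hp : (1 : ℂ) ∈ s) : (0 : ℂ) ∈ leftDomain s := by
  refine ⟨?_, by simp⟩
  have := hsc hm hp (a := 1 / 2) (b := 1 / 2) (by norm_num) (by norm_num) (by norm_num)
  convert this using 1
  simp

/-- A solution holomorphic across both singular points forces the moment of the right-hand side
to vanish. -/
lemma IsJacobiSolution.integral_eq_zero {s : Set ℂ} (hs : IsOpen s) (hsc : Convex ℝ s)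
    (hm : (-1 : ℂ) ∈ s) (hp : (1 : ℂ) ∈ s) {α β : ℂ} (hα : 0 < α.re) (hβ : 0 < β.re)
    {G h : ℂ → ℂ} (hG : ContinuousOn G s) (hh : IsJacobiSolution α β G h s) :
    ∫ t in (-1 : ℝ)..1, (1 - (t : ℂ)) ^ (α - 1) * (1 + (t : ℂ)) ^ (β - 1) * G t = 0 := by
  rw [(jacobi_integral_eq hα hβ (continuousOn_ofReal_Icc_of_convex hsc hm hp hG)).2,
    ← (hh.mono fun z hz ↦ hz.1).eq_leftSolution hs hsc hm hβ (zero_mem_leftDomain hsc hm hp),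
    ← ((hh.reflect hs).mono fun z hz ↦ hz.1).eq_leftSolution hs.neg hsc.neg
      (by simpa using hp) hα (zero_mem_leftDomain hsc.neg (by simpa using hp) (by simpa using hm))]
  simp

/-- The local solution which is holomorphic at `1`. -/
noncomputable def rightSolution (α β : ℂ) (G : ℂ → ℂ) (z : ℂ) : ℂ :=
  -leftSolution β α (fun z ↦ G (-z)) (-z)

/-- `s` with the cut `(-∞, -1]` removed. -/
def rightDomain (s : Set ℂ) : Set ℂ := {z | z ∈ s ∧ 1 + z ∈ slitPlane}

lemma isOpen_rightDomain {s : Set ℂ} (hs : IsOpen s) : IsOpen (rightDomain s) :=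
  hs.inter (isOpen_slitPlane.preimage (by fun_prop : Continuous fun z : ℂ ↦ 1 + z))

lemma isJacobiSolution_rightSolution {s : Set ℂ} (hs : IsOpen s) (hsc : Convex ℝ s)
    (hp : (1 : ℂ) ∈ s) {α β : ℂ} (hα : 0 < α.re) {G : ℂ → ℂ} (hG : DifferentiableOn ℂ G s) :
    IsJacobiSolution α β G (rightSolution α β G) (rightDomain s) := by
  have hG' : DifferentiableOn ℂ (fun z ↦ G (-z)) (Neg.neg ⁻¹' s) :=
    hG.comp (f := fun z : ℂ ↦ -z) (by fun_prop) fun z hz ↦ hz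
  have h := (isJacobiSolution_leftSolution hs.neg hsc.neg
    (by simpa using hp) (α := β) hα hG').reflect (isOpen_leftDomain hs.neg)
  simp only [neg_neg] at h
  refine h.mono fun z hz ↦ ⟨?_, ?_⟩
  · simpa using hz.1
  · simpa using hz.2

lemma leftSolution_eq_rightSolution {s : Set ℂ} (hs : IsOpen s) (hsc : Convex ℝ s)
    (hm : (-1 : ℂ) ∈ s) (hp : (1 : ℂ) ∈ s) {α β : ℂ} (hα : 0 < α.re) (hβ : 0 < β.re)
    {G : ℂ → ℂ} (hG : DifferentiableOn ℂ G s)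
    (hint : ∫ t in (-1 : ℝ)..1, (1 - (t : ℂ)) ^ (α - 1) * (1 + (t : ℂ)) ^ (β - 1) * G t = 0)
    {z : ℂ} (hz : z ∈ leftDomain s ∩ rightDomain s) :
    leftSolution α β G z = rightSolution α β G z := by
  have hL := (isJacobiSolution_leftSolution hs hsc hm (α := α) hβ hG).mono
    (inter_subset_left (t := rightDomain s))
  have hR := (isJacobiSolution_rightSolution hs hsc hp (β := β) hα hG).mono
    (inter_subset_right (s := leftDomain s))
  have hopen : IsOpen (leftDomain s ∩ rightDomain s) :=
    (isOpen_leftDomain hs).inter (isOpen_rightDomain hs)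
  have h0 : (0 : ℂ) ∈ leftDomain s ∩ rightDomain s :=
    ⟨zero_mem_leftDomain hsc hm hp, (zero_mem_leftDomain hsc hm hp).1, by simp⟩
  have hstar : StarConvex ℝ 0 (leftDomain s ∩ rightDomain s) := by
    have h1 : StarConvex ℝ 0 s := hsc.starConvex h0.1.1
    intro y hy a b ha hb hab
    have key : ∀ w : ℂ, 1 + w ∈ slitPlane → 1 + (a • 0 + b • w) ∈ slitPlane := by
      intro w hw
      have := starConvex_one_slitPlane hw ha hb hab
      convert this using 1
      have : (a : ℂ) + b = 1 := by exact_mod_cast hab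
      simp only [real_smul]
      linear_combination -this
    refine ⟨⟨h1 hy.1.1 ha hb hab, ?_⟩, h1 hy.1.1 ha hb hab, key y hy.2.2⟩
    have := key (-y) (by simpa [← sub_eq_add_neg] using hy.1.2)
    convert this using 1
    simp only [real_smul]
    ring
  have hd : ∀ w ∈ leftDomain s ∩ rightDomain s, HasDerivAt
      (fun w ↦ (1 - w) ^ α * (1 + w) ^ β * (leftSolution α β G w - rightSolution α β G w)) 0 w := by
    intro w hw
    have h1 := hasDerivAt_const_sub_cpow α hw.1.2
    have h2 : HasDerivAt (fun w ↦ (1 + w) ^ β) (β * (1 + w) ^ (β - 1)) w := by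
      simpa using ((hasDerivAt_id w).const_add 1).cpow_const (c := β) hw.2.2
    have h3 := (hL.1.differentiableAt (hopen.mem_nhds hw)).hasDerivAt
    have h4 := (hR.1.differentiableAt (hopen.mem_nhds hw)).hasDerivAt
    refine ((h1.mul h2).mul (h3.sub h4)).congr_deriv ?_
    have n1 := slitPlane_ne_zero hw.1.2
    have n2 := slitPlane_ne_zero hw.2.2
    have e1 : (1 - w) ^ α = (1 - w) ^ (α - 1) * (1 - w) := by
      rw [cpow_sub _ _ n1, cpow_one, div_mul_cancel₀ _ n1]
    have e2 : (1 + w) ^ β = (1 + w) ^ (β - 1) * (1 + w) := by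
      rw [cpow_sub _ _ n2, cpow_one, div_mul_cancel₀ _ n2]
    simp only [Pi.mul_apply, Pi.sub_apply, e1, e2]
    linear_combination (1 - w) ^ (α - 1) * (1 + w) ^ (β - 1) * (hL.2 w hw - hR.2 w hw)
  have hconst := hopen.is_const_of_deriv_eq_zero (hstar.isPathConnected h0).isConnected.isPreconnected
    (fun w hw ↦ (hd w hw).differentiableAt.differentiableWithinAt)
    (fun w hw ↦ (hd w hw).deriv) hz h0
  rw [(jacobi_integral_eq hα hβ
    (continuousOn_ofReal_Icc_of_convex hsc hm hp hG.continuousOn)).2] at hint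
  have hzero : leftSolution α β G 0 - rightSolution α β G 0 = 0 := by
    simpa [rightSolution] using hint
  simp only [hzero, mul_zero] at hconst
  have n1 : (1 - z) ^ α ≠ 0 := by
    rw [cpow_def_of_ne_zero (slitPlane_ne_zero hz.1.2)]; exact exp_ne_zero _
  have n2 : (1 + z) ^ β ≠ 0 := by
    rw [cpow_def_of_ne_zero (slitPlane_ne_zero hz.2.2)]; exact exp_ne_zero _
  exact sub_eq_zero.1 ((mul_eq_zero.1 hconst).resolve_left (mul_ne_zero n1 n2))

lemma IsJacobiSolution.congr {α β : ℂ} {G h k : ℂ → ℂ} {s : Set ℂ} (hs : IsOpen s)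
    (hh : IsJacobiSolution α β G h s) (hk : EqOn k h s) : IsJacobiSolution α β G k s := by
  refine ⟨hh.1.congr hk, fun z hz ↦ ?_⟩
  rw [(hk.eventuallyEq_of_mem (hs.mem_nhds hz)).deriv_eq, hk hz, hh.2 z hz]

/-- If the moment of the right-hand side vanishes, the solution holomorphic at `-1` continues
across `1`. -/
lemma exists_isJacobiSolution {s : Set ℂ} (hs : IsOpen s) (hsc : Convex ℝ s)
    (hm : (-1 : ℂ) ∈ s) (hp : (1 : ℂ) ∈ s) {α β : ℂ} (hα : 0 < α.re) (hβ : 0 < β.re)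
    {G : ℂ → ℂ} (hG : DifferentiableOn ℂ G s)
    (hint : ∫ t in (-1 : ℝ)..1, (1 - (t : ℂ)) ^ (α - 1) * (1 + (t : ℂ)) ^ (β - 1) * G t = 0) :
    ∃ h, IsJacobiSolution α β G h s ∧ EqOn h (leftSolution α β G) (leftDomain s) := by
  classical
  let h : ℂ → ℂ := fun z ↦
    if 1 - z ∈ slitPlane then leftSolution α β G z else rightSolution α β G z
  have hleft : EqOn h (leftSolution α β G) (leftDomain s) := fun z hz ↦ if_pos hz.2
  have hright : EqOn h (rightSolution α β G) (rightDomain s) := by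
    intro z hz
    by_cases h1 : 1 - z ∈ slitPlane
    · rw [hleft ⟨hz.1, h1⟩]
      exact leftSolution_eq_rightSolution hs hsc hm hp hα hβ hG hint ⟨⟨hz.1, h1⟩, hz⟩
    · exact if_neg h1
  have hL := (isJacobiSolution_leftSolution hs hsc hm (α := α) hβ hG).congr
    (isOpen_leftDomain hs) hleft
  have hR := (isJacobiSolution_rightSolution hs hsc hp (β := β) hα hG).congr
    (isOpen_rightDomain hs) hright
  have hcover : ∀ z ∈ s, z ∈ leftDomain s ∨ z ∈ rightDomain s := by
    intro z hz
    by_cases h1 : 1 - z ∈ slitPlane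
    · exact Or.inl ⟨hz, h1⟩
    · refine Or.inr ⟨hz, ?_⟩
      rw [mem_slitPlane_iff] at h1 ⊢
      push Not at h1
      left
      simp only [sub_re, add_re, one_re] at h1 ⊢
      linarith [h1.1]
  refine ⟨h, ⟨fun z hz ↦ ?_, fun z hz ↦ ?_⟩, hleft⟩
  · rcases hcover z hz with hz | hz
    · exact (hL.1.differentiableAt ((isOpen_leftDomain hs).mem_nhds hz)).differentiableWithinAt
    · exact (hR.1.differentiableAt ((isOpen_rightDomain hs).mem_nhds hz)).differentiableWithinAt
  · rcases hcover z hz with hz | hz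
    · exact hL.2 z hz
    · exact hR.2 z hz

/-- `k` is holomorphic on `s` and solves `x (y - x) k' + (β y - (α + β) x) k = 1` there; the
singular points of this equation are `0` and `y`. -/
def IsTwoPointSolution (α β y : ℂ) (k : ℂ → ℂ) (s : Set ℂ) : Prop :=
  DifferentiableOn ℂ k s ∧
    ∀ x ∈ s, x * (y - x) * deriv k x + (β * y - (α + β) * x) * k x = 1

lemma IsTwoPointSolution.mono {α β y : ℂ} {k : ℂ → ℂ} {s t : Set ℂ}
    (hk : IsTwoPointSolution α β y k t) (hst : s ⊆ t) : IsTwoPointSolution α β y k s :=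
  ⟨hk.1.mono hst, fun z hz ↦ hk.2 z (hst hz)⟩

/-- A local solution continues to every disc avoiding the singular points. -/
lemma IsTwoPointSolution.exists_extension {α β y : ℂ} {k : ℂ → ℂ} {U : Set ℂ} (hU : IsOpen U)
    (hk : IsTwoPointSolution α β y k U) {x : ℂ} (hx : x ∈ U) {R : ℝ} (hR : 0 < R)
    (h0 : ∀ z ∈ ball x R, z ≠ 0) (hy : ∀ z ∈ ball x R, z ≠ y) :
    ∃ L, IsTwoPointSolution α β y L (ball x R) ∧ L =ᶠ[nhds x] k := by
  have hne : ∀ z ∈ ball x R, z * (y - z) ≠ 0 :=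
    fun z hz ↦ mul_ne_zero (h0 z hz) (sub_ne_zero.2 (hy z hz).symm)
  have hp : DifferentiableOn ℂ (fun z ↦ (β * y - (α + β) * z) / (z * (y - z))) (ball x R) :=
    DifferentiableOn.div (by fun_prop) (by fun_prop) hne
  obtain ⟨P, hP⟩ := hp.isExactOn_ball
  have hPd : DifferentiableOn ℂ P (ball x R) :=
    fun z hz ↦ (hP z hz).differentiableAt.differentiableWithinAt
  have hq : DifferentiableOn ℂ (fun z ↦ exp (P z) / (z * (y - z))) (ball x R) :=
    DifferentiableOn.div hPd.cexp (by fun_prop) hne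
  obtain ⟨Q, hQx, hQ⟩ := hq.isExactOn_ball.with_val_at x (k x * exp (P x))
  have hL : ∀ z ∈ ball x R, HasDerivAt (fun z ↦ Q z * exp (-P z))
      (exp (P z) / (z * (y - z)) * exp (-P z) +
        Q z * (exp (-P z) * -((β * y - (α + β) * z) / (z * (y - z))))) z :=
    fun z hz ↦ (hQ z hz).mul (hP z hz).neg.cexp
  refine ⟨fun z ↦ Q z * exp (-P z),
    ⟨fun z hz ↦ (hL z hz).differentiableAt.differentiableWithinAt, fun z hz ↦ ?_⟩, ?_⟩
  · rw [(hL z hz).deriv]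
    have h1 := hne z hz
    have h2 := h0 z hz
    have h3 := right_ne_zero_of_mul h1
    have h4 : exp (P z) * exp (-P z) = 1 := by rw [← exp_add]; simp
    field_simp
    linear_combination h4
  · obtain ⟨r, hr, hrU⟩ := Metric.isOpen_iff.1 (hU.inter isOpen_ball) x ⟨hx, mem_ball_self hR⟩
    have hd : ∀ z ∈ ball x r, HasDerivAt (fun z ↦ k z * exp (P z)) (exp (P z) / (z * (y - z))) z := by
      intro z hz
      have hkz := (hk.1.differentiableAt (hU.mem_nhds (hrU hz).1)).hasDerivAt
      refine (hkz.mul (hP z (hrU hz).2).cexp).congr_deriv ?_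
      have h1 := hne z (hrU hz).2
      have h2 := h0 z (hrU hz).2
      have h3 := right_ne_zero_of_mul h1
      have h4 := hk.2 z (hrU hz).1
      field_simp
      linear_combination h4
    have heq := isOpen_ball.eqOn_of_deriv_eq (convex_ball x r).isPreconnected
      (fun z hz ↦ (hQ z (hrU hz).2).differentiableAt.differentiableWithinAt)
      (fun z hz ↦ (hd z hz).differentiableAt.differentiableWithinAt)
      (fun z hz ↦ by rw [(hQ z (hrU hz).2).deriv, (hd z hz).deriv]) (mem_ball_self hr) hQx
    filter_upwards [ball_mem_nhds x hr] with z hz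
    rw [heq hz, mul_assoc, ← exp_add]
    simp

/-- Moving the second singular point from `y` to `y / m` by dilation: a solution is transported
as soon as each of its germs continues far enough. -/
lemma IsTwoPointSolution.transport {α β y m : ℂ} (hm : m ≠ 0) {k : ℂ → ℂ} {U : Set ℂ}
    (hU : IsOpen U)
    (hloc : ∀ x ∈ U, ∃ R, ‖m - 1‖ * ‖x‖ < R ∧ ∃ L,
      IsTwoPointSolution α β y L (ball x R) ∧ L =ᶠ[nhds x] k) :
    ∃ k', IsTwoPointSolution α β (y / m) k' U := by
  choose! R hR L hL hLk using hloc
  have hRpos : ∀ x ∈ U, 0 < R x := fun x hx ↦ lt_of_le_of_lt (by positivity) (hR x hx)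
  have hmem : ∀ x ∈ U, m * x ∈ ball x (R x) := by
    intro x hx
    rw [mem_ball, dist_eq_norm, show m * x - x = (m - 1) * x by ring, norm_mul]
    exact hR x hx
  have hglue : ∀ x₀ ∈ U, (fun x ↦ m * L x (m * x)) =ᶠ[nhds x₀] fun x ↦ m * L x₀ (m * x) := by
    intro x₀ hx₀
    have hnear : ∀ᶠ x in nhds x₀, m * x ∈ ball x₀ (R x₀) :=
      (by fun_prop : ContinuousAt (fun x ↦ m * x) x₀).eventually
        (isOpen_ball.mem_nhds (hmem x₀ hx₀))
    filter_upwards [hU.mem_nhds hx₀, hnear, (hLk x₀ hx₀).eventuallyEq_nhds,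
      ball_mem_nhds x₀ (hRpos x₀ hx₀)] with x hx hmx hev hxb
    have han : ∀ w ∈ U, AnalyticOnNhd ℂ (L w) (ball w (R w)) :=
      fun w hw ↦ (hL w hw).1.analyticOnNhd isOpen_ball
    have hpre : IsPreconnected (ball x (R x) ∩ ball x₀ (R x₀)) :=
      ((convex_ball _ _).inter (convex_ball _ _)).isPreconnected
    have := ((han x hx).mono inter_subset_left).eqOn_of_preconnected_of_eventuallyEq
      ((han x₀ hx₀).mono inter_subset_right) hpre ⟨mem_ball_self (hRpos x hx), hxb⟩
      ((hLk x hx).trans hev.symm)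
    rw [this ⟨hmem x hx, hmx⟩]
  have hd : ∀ x₀ ∈ U, HasDerivAt (fun x ↦ m * L x (m * x))
      (m * (deriv (L x₀) (m * x₀) * m)) x₀ := by
    intro x₀ hx₀
    have h1 := ((hL x₀ hx₀).1.differentiableAt
      (isOpen_ball.mem_nhds (hmem x₀ hx₀))).hasDerivAt
    have h2 : HasDerivAt (fun x ↦ m * x) m x₀ := by simpa using (hasDerivAt_id x₀).const_mul m
    exact ((h1.comp x₀ h2).const_mul m).congr_of_eventuallyEq (hglue x₀ hx₀)
  refine ⟨fun x ↦ m * L x (m * x),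
    fun x hx ↦ (hd x hx).differentiableAt.differentiableWithinAt, fun x hx ↦ ?_⟩
  rw [(hd x hx).deriv]
  have hym : y / m * m = y := div_mul_cancel₀ _ hm
  linear_combination (hL x hx).2 _ (hmem x hx) +
    (x * m * deriv (L x) (m * x) + β * L x (m * x)) * hym

/-- A nearby displacement of the second singular point, quantitatively. -/
lemma IsTwoPointSolution.exists_move {α β y y' : ℂ} {k : ℂ → ℂ} {U : Set ℂ} (hU : IsOpen U)
    (hk : IsTwoPointSolution α β y k U) (hy : y ≠ 0) (hy' : y' ≠ 0) {σ d : ℝ} (hσ : 0 < σ)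
    (hσU : ball 0 σ ⊆ U) (hd : 0 < d) (hdU : ball y (2 * d) ⊆ U)
    (h1 : ‖y / y' - 1‖ < 1 / 2) (h2 : ‖y / y' - 1‖ * ‖y‖ < d / 2) :
    ∃ k', IsTwoPointSolution α β y' k' U := by
  have := IsTwoPointSolution.transport (α := α) (β := β) (y := y) (m := y / y') (k := k)
    (div_ne_zero hy hy') hU ?_
  · rwa [div_div_cancel₀ hy] at this
  set ε := ‖y / y' - 1‖
  have hε : 0 ≤ ε := norm_nonneg _
  intro x hx
  by_cases hx0 : ‖x‖ < σ / 2
  · refine ⟨σ / 2, by nlinarith [norm_nonneg x], k, hk.mono fun z hz ↦ hσU ?_, .rfl⟩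
    rw [mem_ball, dist_eq_norm] at hz ⊢
    have := norm_add_le (z - x) x
    rw [sub_add_cancel] at this
    rw [sub_zero]
    linarith
  have htri : ‖x‖ ≤ ‖x - y‖ + ‖y‖ := by simpa using norm_add_le (x - y) y
  by_cases hxy : ‖x - y‖ < d
  · refine ⟨d, by nlinarith [norm_nonneg (x - y)], k, hk.mono fun z hz ↦ hdU ?_, .rfl⟩
    rw [mem_ball, dist_eq_norm] at hz ⊢
    have := norm_sub_le_norm_sub_add_norm_sub z x y
    linarith
  push Not at hx0 hxy
  have hxpos : 0 < ‖x‖ := by linarith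
  refine ⟨min ‖x‖ ‖x - y‖, lt_min (by nlinarith) (by nlinarith [norm_nonneg (x - y)]),
    hk.exists_extension hU hx (lt_min hxpos (by linarith)) ?_ ?_⟩
  · rintro z hz rfl
    rw [mem_ball, dist_eq_norm, zero_sub, norm_neg] at hz
    exact absurd (hz.trans_le (min_le_left _ _)) (lt_irrefl _)
  · rintro z hz rfl
    rw [mem_ball, dist_comm, dist_eq_norm] at hz
    exact absurd (hz.trans_le (min_le_right _ _)) (lt_irrefl _)

lemma eventually_isTwoPointSolution_iff {α β : ℂ} {U : Set ℂ} (hU : IsOpen U)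
    (h0 : (0 : ℂ) ∈ U) {y₀ : ℂ} (hy₀ : y₀ ∈ U) (hne : y₀ ≠ 0) :
    ∀ᶠ y in nhds y₀,
      ((∃ k, IsTwoPointSolution α β y₀ k U) ↔ ∃ k, IsTwoPointSolution α β y k U) := by
  obtain ⟨σ, hσ, hσU⟩ := Metric.isOpen_iff.1 hU 0 h0
  obtain ⟨r, hr, hrU⟩ := Metric.isOpen_iff.1 hU y₀ hy₀
  have c1 : ContinuousAt (fun y ↦ ‖y₀ / y - 1‖) y₀ :=
    ((continuousAt_const.div continuousAt_id hne).sub continuousAt_const).norm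
  have c2 : ContinuousAt (fun y ↦ ‖y / y₀ - 1‖) y₀ := by fun_prop
  have c3 : ContinuousAt (fun y ↦ ‖y‖) y₀ := by fun_prop
  have z1 : ‖y₀ / y₀ - 1‖ = 0 := by simp [hne]
  have hr' : 0 < r / 4 / 2 := by positivity
  have e1 : ∀ᶠ y in nhds y₀, ‖y₀ / y - 1‖ < 1 / 2 :=
    c1.eventually (gt_mem_nhds (z1.trans_lt (by norm_num)))
  have e2 : ∀ᶠ y in nhds y₀, ‖y / y₀ - 1‖ < 1 / 2 :=
    c2.eventually (gt_mem_nhds (z1.trans_lt (by norm_num)))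
  have e3 : ∀ᶠ y in nhds y₀, ‖y₀ / y - 1‖ * ‖y₀‖ < r / 4 / 2 :=
    (c1.mul continuousAt_const).eventually
      (gt_mem_nhds (show ‖y₀ / y₀ - 1‖ * ‖y₀‖ < r / 4 / 2 by rwa [z1, zero_mul]))
  have e4 : ∀ᶠ y in nhds y₀, ‖y / y₀ - 1‖ * ‖y‖ < r / 4 / 2 :=
    (c2.mul c3).eventually
      (gt_mem_nhds (show ‖y₀ / y₀ - 1‖ * ‖y₀‖ < r / 4 / 2 by rwa [z1, zero_mul]))
  filter_upwards [eventually_ne_nhds hne, ball_mem_nhds y₀ (half_pos hr), e1, e2, e3, e4]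
    with y hy hyb h1 h2 h3 h4
  have hball : ball y (2 * (r / 4)) ⊆ U := by
    refine (ball_subset_ball' ?_).trans hrU
    rw [mem_ball] at hyb
    linarith
  constructor
  · rintro ⟨k, hk⟩
    exact hk.exists_move hU hne hy hσ hσU (d := r / 4) (by linarith)
      ((ball_subset_ball (by linarith)).trans hrU) h1 h3
  · rintro ⟨k, hk⟩
    exact hk.exists_move hU hy hne hσ hσU (d := r / 4) (by linarith) hball h2 h4

lemma cBeta_eq_betaIntegral {α β : ℂ} (hα : 0 < α.re) (hβ : 0 < β.re) :
    cBeta α β = betaIntegral α β := by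
  rw [cBeta, Gamma_mul_Gamma_eq_betaIntegral hα hβ,
    mul_div_cancel_left₀ _ (Gamma_ne_zero_of_re_pos (by simpa using add_pos hα hβ))]

lemma cBeta_ne_zero {α β : ℂ} (hα : 0 < α.re) (hβ : 0 < β.re) : cBeta α β ≠ 0 :=
  div_ne_zero (mul_ne_zero (Gamma_ne_zero_of_re_pos hα) (Gamma_ne_zero_of_re_pos hβ))
    (Gamma_ne_zero_of_re_pos (by simpa using add_pos hα hβ))

lemma integral_jacobiWeight {α β : ℂ} (hα : 0 < α.re) (hβ : 0 < β.re) :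
    ∫ t in (-1 : ℝ)..1, (1 - (t : ℂ)) ^ (α - 1) * (1 + (t : ℂ)) ^ (β - 1) =
      2 ^ (α + β - 1) * cBeta α β := by
  have h := betaIntegral_scaled β α (a := 2) two_pos
  rw [cBeta_eq_betaIntegral hα hβ, ← betaIntegral_symm, add_comm α β]
  push_cast at h
  rw [← h]
  have := intervalIntegral.integral_comp_add_right (a := -1) (b := 1)
    (fun x : ℝ ↦ (x : ℂ) ^ (β - 1) * (2 - (x : ℂ)) ^ (α - 1)) 1
  norm_num at this
  rw [← this]
  refine intervalIntegral.integral_congr fun t _ ↦ ?_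
  rw [mul_comm, add_comm (1 : ℂ), show (2 : ℂ) - (t + 1) = 1 - t by ring]

lemma integral_jacobiWeight_ne_zero {α β : ℂ} (hα : 0 < α.re) (hβ : 0 < β.re) :
    ∫ t in (-1 : ℝ)..1, (1 - (t : ℂ)) ^ (α - 1) * (1 + (t : ℂ)) ^ (β - 1) ≠ 0 := by
  rw [integral_jacobiWeight hα hβ]
  exact mul_ne_zero (by simp [cpow_eq_zero_iff]) (cBeta_ne_zero hα hβ)

lemma not_isTwoPointSolution_of_ball_subset {α β y : ℂ} (hα : 0 < α.re) (hβ : 0 < β.re)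
    {U : Set ℂ} (hU : IsOpen U) {σ : ℝ} (hσU : ball 0 σ ⊆ U) (hy : y ≠ 0) (hyσ : ‖y‖ < σ)
    (k : ℂ → ℂ) : ¬ IsTwoPointSolution α β y k U := by
  intro hk
  have hypos : 0 < ‖y‖ := norm_pos_iff.2 hy
  have hmem : ∀ z ∈ ball (-1 : ℂ) (2 * σ / ‖y‖), y * (z + 1) / 2 ∈ U := by
    intro z hz
    rw [mem_ball, dist_eq_norm, sub_neg_eq_add, lt_div_iff₀ hypos] at hz
    apply hσU
    rw [mem_ball_zero_iff, norm_div, norm_mul, RCLike.norm_ofNat]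
    linarith
  have hd : ∀ z ∈ ball (-1 : ℂ) (2 * σ / ‖y‖), HasDerivAt (fun z ↦ y / 2 * k (y * (z + 1) / 2))
      (y / 2 * (deriv k (y * (z + 1) / 2) * (y / 2))) z := by
    intro z hz
    have h1 := (hk.1.differentiableAt (hU.mem_nhds (hmem z hz))).hasDerivAt
    have h2 : HasDerivAt (fun z ↦ y * (z + 1) / 2) (y / 2) z := by
      simpa using (((hasDerivAt_id z).add_const 1).const_mul y).div_const 2
    exact (h1.comp z h2).const_mul _
  have hK : IsJacobiSolution α β (fun _ ↦ 1) (fun z ↦ y / 2 * k (y * (z + 1) / 2))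
      (ball (-1 : ℂ) (2 * σ / ‖y‖)) := by
    refine ⟨fun z hz ↦ (hd z hz).differentiableAt.differentiableWithinAt, fun z hz ↦ ?_⟩
    rw [(hd z hz).deriv]
    linear_combination hk.2 _ (hmem z hz)
  have h2σ : 2 < 2 * σ / ‖y‖ := by
    rw [lt_div_iff₀ hypos]
    linarith
  have := hK.integral_eq_zero isOpen_ball (convex_ball _ _)
    (mem_ball_self (by linarith)) (by rw [mem_ball, dist_eq_norm]; norm_num; exact h2σ) hα hβ
    continuousOn_const
  simp only [mul_one] at this
  exact integral_jacobiWeight_ne_zero hα hβ this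

/-- On a connected neighbourhood of the two singular points there is no solution. -/
lemma not_isTwoPointSolution {α β y : ℂ} (hα : 0 < α.re) (hβ : 0 < β.re) {U : Set ℂ}
    (hU : IsOpen U) (hUc : IsPreconnected U) (h0 : (0 : ℂ) ∈ U) (hyU : y ∈ U) (hy : y ≠ 0)
    (k : ℂ → ℂ) : ¬ IsTwoPointSolution α β y k U := by
  intro hk
  let Q : ℂ → Prop := fun y ↦ y ≠ 0 ∧ ∃ k, IsTwoPointSolution α β y k U
  have hloc : ∀ x ∈ U, ∀ᶠ z in nhds x, Q x ↔ Q z := by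
    intro x hx
    by_cases hx0 : x = 0
    · subst hx0
      obtain ⟨σ, hσ, hσU⟩ := Metric.isOpen_iff.1 hU 0 h0
      filter_upwards [ball_mem_nhds 0 hσ] with z hz
      refine iff_of_false (fun h ↦ h.1 rfl) fun ⟨hz0, k, hk⟩ ↦ ?_
      exact not_isTwoPointSolution_of_ball_subset hα hβ hU hσU hz0 (mem_ball_zero_iff.1 hz) k hk
    · filter_upwards [eventually_ne_nhds hx0, eventually_isTwoPointSolution_iff hU h0 hx hx0]
        with z hz hiff
      exact and_congr (iff_of_true hx0 hz) hiff
  have key : Q 0 ↔ Q y := hUc.induction₂ (fun x z ↦ (Q x ↔ Q z))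
    (fun x hx ↦ (hloc x hx).filter_mono nhdsWithin_le_nhds)
    (fun _ _ _ _ _ _ h h' ↦ h.trans h') (fun _ _ _ _ h ↦ h.symm) h0 hyU
  exact (key.2 ⟨hy, k, hk⟩).1 rfl

lemma integral_jacobiWeight_mul_sub_PhiOp {a b ν : ℂ} (hα : 0 < (ν * a).re)
    (hβ : 0 < (ν * b).re) {F : ℂ → ℂ} (hF : ContinuousOn (fun t : ℝ ↦ F t) (Icc (-1) 1)) :
    ∫ t in (-1 : ℝ)..1, (1 - (t : ℂ)) ^ (ν * a - 1) * (1 + (t : ℂ)) ^ (ν * b - 1) *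
      (F t - PhiOp a b ν F) = 0 := by
  have h1 := (jacobi_integral_eq hα hβ hF).1
  have h2 := (jacobi_integral_eq hα hβ (G := fun _ ↦ PhiOp a b ν F) continuousOn_const).1
  simp only [mul_sub]
  rw [intervalIntegral.integral_sub h1 h2, intervalIntegral.integral_mul_const,
    integral_jacobiWeight hα hβ, PhiOp]
  have hc := cBeta_ne_zero hα hβ
  have h3 : (2 : ℂ) ^ (ν * a + ν * b - 1) * 2 ^ (1 - ν * (a + b)) = 1 := by
    rw [← cpow_add _ _ two_ne_zero]
    ring_nf
    simp
  set X := ∫ t in (-1 : ℝ)..1,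
    (1 - (t : ℂ)) ^ (ν * a - 1) * (1 + (t : ℂ)) ^ (ν * b - 1) * F t
  linear_combination (-X) * h3 - (2 : ℂ) ^ (ν * a + ν * b - 1) * 2 ^ (1 - ν * (a + b)) * X *
    mul_inv_cancel₀ hc

lemma OffCut.one_sub_mem_slitPlane {z : ℂ} (hz : OffCut z) : 1 - z ∈ slitPlane := by
  rw [mem_slitPlane_iff]
  rcases hz with h | h
  · exact Or.inr (by simpa using h)
  · exact Or.inl (by simpa using h.2)

lemma OffCut.one_add_ne_zero {z : ℂ} (hz : OffCut z) : 1 + z ≠ 0 := by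
  intro h
  obtain rfl : z = -1 := by linear_combination h
  simp [OffCut] at hz

lemma leftSolution_eq_JOp {a b ν : ℂ} (F : ℂ → ℂ) {z : ℂ} (hz : 1 + z ≠ 0) :
    leftSolution (ν * a) (ν * b) (fun z ↦ F z - PhiOp a b ν F) z = JOp a b ν F z := by
  rw [leftSolution, JOp, mul_assoc, radialMean]
  congr 1
  rw [← intervalIntegral.integral_const_mul]
  refine intervalIntegral.integral_congr_ae (Filter.Eventually.of_forall fun s hs ↦ ?_)
  rw [uIoc_of_le zero_le_one] at hs
  have hs0 : (s : ℂ) ≠ 0 := ofReal_ne_zero.2 hs.1.ne'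
  have hmul : ((s : ℂ) * (1 + z)) ^ (ν * b - 1) =
      (s : ℂ) ^ (ν * b - 1) * (1 + z) ^ (ν * b - 1) := by
    rw [cpow_def_of_ne_zero (mul_ne_zero hs0 hz), cpow_def_of_ne_zero hs0,
      cpow_def_of_ne_zero hz, log_ofReal_mul hs.1 hz, ← exp_add, ofReal_log hs.1.le]
    ring_nf
  have hcancel : (1 + z) ^ (-(ν * b)) * ((1 + z) * (1 + z) ^ (ν * b - 1)) = 1 := by
    rw [cpow_sub _ _ hz, cpow_neg, cpow_one]
    have : (1 + z) ^ (ν * b) ≠ 0 := by simp [cpow_eq_zero_iff, hz]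
    field_simp
  rw [show (1 : ℂ) + (-1 + s * (z + 1)) = s * (1 + z) by ring, hmul,
    show (1 : ℂ) - (-1 + s * (z + 1)) = 2 - s * (z + 1) by ring,
    show (-1 : ℂ) + s * (z + 1) = s * (z + 1) - 1 by ring, add_comm z 1]
  linear_combination (-((s : ℂ) ^ (ν * b - 1) * ((2 - s * (1 + z)) ^ (ν * a - 1) *
    (F (s * (1 + z) - 1) - PhiOp a b ν F)))) * hcancel

/-- Two right-hand sides differing by a constant cannot both admit solutions holomorphic on a
connected neighbourhood of the singular points. -/
lemma IsJacobiSolution.const_eq {α β : ℂ} (hα : 0 < α.re) (hβ : 0 < β.re) {F g h : ℂ → ℂ}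
    {p q : ℂ} {U : Set ℂ} (hU : IsOpen U) (hUc : IsPreconnected U) (hm : (-1 : ℂ) ∈ U)
    (hp : (1 : ℂ) ∈ U) (hg : IsJacobiSolution α β (fun z ↦ F z - p) g U)
    (hh : IsJacobiSolution α β (fun z ↦ F z - q) h U) : p = q := by
  by_contra hne
  have hμ : q - p ≠ 0 := sub_ne_zero.2 (Ne.symm hne)
  have hshift : Continuous fun x : ℂ ↦ x - 1 := by fun_prop
  have hpre : IsPreconnected {x : ℂ | x - 1 ∈ U} := by
    have := hUc.image (fun x : ℂ ↦ x + 1) (by fun_prop)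
    convert this using 1
    ext x
    simp [sub_eq_add_neg]
  have hd : ∀ x ∈ {x : ℂ | x - 1 ∈ U}, HasDerivAt (fun x ↦ (g (x - 1) - h (x - 1)) / (q - p))
      ((deriv g (x - 1) - deriv h (x - 1)) / (q - p)) x := by
    intro x hx
    have h1 := (hg.1.differentiableAt (hU.mem_nhds hx)).hasDerivAt.comp_sub_const x 1
    have h2 := (hh.1.differentiableAt (hU.mem_nhds hx)).hasDerivAt.comp_sub_const x 1
    exact (h1.sub h2).div_const _
  refine not_isTwoPointSolution hα hβ (hU.preimage hshift) hpre (y := 2) (by simpa using hm)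
    (by simp only [mem_preimage]; norm_num; exact hp) two_ne_zero
    (fun x ↦ (g (x - 1) - h (x - 1)) / (q - p))
    ⟨fun x hx ↦ (hd x hx).differentiableAt.differentiableWithinAt, fun x hx ↦ ?_⟩
  rw [(hd x hx).deriv]
  field_simp
  linear_combination hg.2 _ hx - hh.2 _ hx

/-- for every `n ≥ 1` and every `F ∈ B_ρ`, `J_{n+1}[F]` extends to a function
analytic on the whole disk `D_ρ` (in particular analytic at `±1`) which satisfies the ODE
`(1-x²) h′(x) + n[(b-a) - (a+b)x] h(x) = F(x) - Φ_{n+1}[F]` on `D_ρ`; moreover `Φ_{n+1}[F]`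
is the unique constant `λ` for which this ODE admits a solution analytic in a (connected)
neighborhood of both `-1` and `1`. -/
theorem stmt3 (a b c : ℂ) (ha : 0 < a.re) (hb : 0 < b.re) (hc : c = (b - a) / (a + b))
    (ρmin ρ0 ρ : ℝ) (hρmin : 0 < ρmin)
    (hm : (-1 : ℂ) ∈ ball c ρmin) (hp : (1 : ℂ) ∈ ball c ρmin)
    (hρ0 : ρmin < ρ0) (hρ : ρ ∈ Icc ρmin ρ0)
    (n : ℕ) (hn : 1 ≤ n)
    (F : ℂ → ℂ) (hF : DifferentiableOn ℂ F (ball c ρ))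
    (hFc : ContinuousOn F (closedBall c ρ)) :
    (∃ h : ℂ → ℂ,
      DifferentiableOn ℂ h (ball c ρ) ∧
      (∀ z ∈ ball c ρ, OffCut z → h z = JOp a b (n : ℂ) F z) ∧
      (∀ x ∈ ball c ρ,
        (1 - x ^ 2) * deriv h x + (n : ℂ) * ((b - a) - (a + b) * x) * h x
          = F x - PhiOp a b (n : ℂ) F)) ∧
    (∀ (lam : ℂ) (g : ℂ → ℂ) (U : Set ℂ), IsOpen U → IsPreconnected U →
      (-1 : ℂ) ∈ U → (1 : ℂ) ∈ U → U ⊆ ball c ρ → DifferentiableOn ℂ g U →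
      (∀ x ∈ U,
        (1 - x ^ 2) * deriv g x + (n : ℂ) * ((b - a) - (a + b) * x) * g x = F x - lam) →
      lam = PhiOp a b (n : ℂ) F) := by
  have hα : 0 < ((n : ℂ) * a).re := by
    rw [← ofReal_natCast, re_ofReal_mul]
    exact mul_pos (by exact_mod_cast hn) ha
  have hβ : 0 < ((n : ℂ) * b).re := by
    rw [← ofReal_natCast, re_ofReal_mul]
    exact mul_pos (by exact_mod_cast hn) hb
  have hsub := ball_subset_ball (x := c) hρ.1
  have hint := integral_jacobiWeight_mul_sub_PhiOp hα hβ (F := F)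
    (continuousOn_ofReal_Icc_of_convex (convex_ball c ρ) (hsub hm) (hsub hp) hF.continuousOn)
  obtain ⟨h, hh, hleft⟩ := exists_isJacobiSolution isOpen_ball (convex_ball c ρ) (hsub hm)
    (hsub hp) hα hβ (hF.sub_const (PhiOp a b n F)) hint
  refine ⟨⟨h, hh.1, fun z hz hcut ↦ ?_, fun x hx ↦ ?_⟩, ?_⟩
  · rw [hleft ⟨hz, hcut.one_sub_mem_slitPlane⟩, leftSolution_eq_JOp F hcut.one_add_ne_zero]
  · linear_combination hh.2 x hx
  · intro lam g U hU hUc hmU hpU hUρ hg hode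
    exact IsJacobiSolution.const_eq hα hβ hU hUc hmU hpU
      ⟨hg, fun x hx ↦ by linear_combination hode x hx⟩ (hh.mono hUρ)
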